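/- Let p be a prime with p > 3, or p = 3 with n > 1; let f ∈ ℤ[X] and let v ∈ ZMod p^n be a periodic point of F_{p^n} of minimal period k with λ̄(v) = 1 in ZMod p and r_v ≠ 0. If w ∈ ZMod p^{n+1} is a lift of v that is a periodic point of F_{p^{n+1}}, then r_w ≠ 0. -/

import Mathlib

/-- The map on `ZMod m` induced by a polynomial `f ∈ ℤ[X]`. -/
noncomputable def polyMap (m : ℕ) (f : Polynomial ℤ) : ZMod m → ZMod m :=
  fun x => Polynomial.aeval x f

/-- The multiplier `λ(v) = ∏_{i=0}^{k-1} f'(F_m^i(v)) ∈ ZMod m` of a periodic point `v`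
of minimal period `k`. -/
noncomputable def multiplier (m : ℕ) (f : Polynomial ℤ) (k : ℕ) (v : ZMod m) : ZMod m :=
  ∏ i ∈ Finset.range k, Polynomial.aeval ((polyMap m f)^[i] v) (Polynomial.derivative f)

/-- `f^{∘k} : ℤ → ℤ`, the `k`-fold iterate of the polynomial map of `f`. -/
noncomputable def polyIter (f : Polynomial ℤ) (k : ℕ) : ℤ → ℤ :=
  (fun x : ℤ => Polynomial.eval x f)^[k]

open Polynomial in
/-- Third order Taylor expansion of an integral polynomial. -/
lemma exists_eval_add_eq_taylor_three (g : ℤ[X]) (a : ℤ) :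
    ∃ h : ℤ, ∀ x : ℤ, ∃ c : ℤ,
      g.eval (a + x) = g.eval a + g.derivative.eval a * x + h * x ^ 2 + c * x ^ 3 := by
  have key (q : ℤ[X]) (x : ℤ) : q.eval x = q.divX.eval x * x + q.coeff 0 := by
    conv_lhs => rw [← divX_mul_X_add q]
    simp
  refine ⟨(taylor a g).coeff 2, fun x => ⟨(taylor a g).divX.divX.divX.eval x, ?_⟩⟩
  have h0 : g.eval (a + x) = (taylor a g).eval x := by rw [taylor_eval, add_comm]
  rw [h0, key, key (divX _), key (divX (divX _))]
  simp only [coeff_divX, zero_add, taylor_coeff_zero, taylor_coeff_one, Nat.reduceAdd]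
  ring

open Polynomial in
/-- The orbit of `a` under an integral polynomial `g` with `g(a) = a + p ^ (m + 1) * s` and
`g'(a) = 1 + p * u`, up to a multiple of `p ^ (m + 3)`. -/
lemma exists_iterate_eval_eq (g : ℤ[X]) (p a s u : ℤ) (m : ℕ)
    (hg : g.eval a = a + p ^ (m + 1) * s) (hu : g.derivative.eval a = 1 + p * u) :
    ∃ h : ℤ, ∀ j : ℕ, ∃ e : ℤ, (fun x => g.eval x)^[j] a = a + p ^ (m + 1) * (j * s +
      p * (u * s * ∑ i ∈ Finset.range j, (i : ℤ) +
        h * p ^ m * s ^ 2 * ∑ i ∈ Finset.range j, (i : ℤ) ^ 2) + p ^ 2 * e) := by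
  obtain ⟨h, hh⟩ := exists_eval_add_eq_taylor_three g a
  refine ⟨h, fun j => ?_⟩
  induction j with
  | zero => exact ⟨0, by simp⟩
  | succ j ih =>
    obtain ⟨e, he⟩ := ih
    rw [Function.iterate_succ_apply', he, Finset.sum_range_succ, Finset.sum_range_succ]
    generalize ∑ i ∈ Finset.range j, (i : ℤ) = T
    generalize ∑ i ∈ Finset.range j, (i : ℤ) ^ 2 = Q
    set B := u * s * T + h * p ^ m * s ^ 2 * Q with hB
    set y := (j : ℤ) * s + p * B + p ^ 2 * e with hy
    obtain ⟨c, hc⟩ := hh (p ^ (m + 1) * y)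
    clear_value y B
    refine ⟨e + u * (B + p * e) + h * p ^ m * (2 * j * s * (B + p * e) + p * (B + p * e) ^ 2)
      + c * (p ^ m) ^ 2 * y ^ 3, ?_⟩
    rw [hc, hg, hu, pow_succ p m]
    clear hc he hg
    generalize p ^ m = q at *
    push_cast
    linear_combination (p * q + p * q * p * u +
      h * p ^ 2 * q ^ 2 * (y + (j * s + p * B + p ^ 2 * e))) * hy + p ^ 2 * q * hB

lemma six_mul_sum_range_sq (j : ℕ) :
    6 * ∑ i ∈ Finset.range j, (i : ℤ) ^ 2 = (j - 1) * j * (2 * j - 1) := by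
  induction j with
  | zero => simp
  | succ j ih => rw [Finset.sum_range_succ, mul_add, ih]; push_cast; ring

lemma two_mul_sum_range_intCast (j : ℕ) :
    2 * ∑ i ∈ Finset.range j, (i : ℤ) = (j - 1) * j := by
  induction j with
  | zero => simp
  | succ j ih => rw [Finset.sum_range_succ, mul_add, ih]; push_cast; ring

lemma Nat.Prime.dvd_sum_range_intCast {p : ℕ} (hp : p.Prime) (h2 : 2 < p) :
    (p : ℤ) ∣ ∑ i ∈ Finset.range p, (i : ℤ) := by
  have h : (p : ℤ) ∣ 2 * ∑ i ∈ Finset.range p, (i : ℤ) := by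
    rw [two_mul_sum_range_intCast]; exact Dvd.intro_left _ rfl
  refine ((Nat.prime_iff_prime_int.mp hp).dvd_or_dvd h).resolve_left fun h' => ?_
  have := Int.le_of_dvd (by norm_num) h'
  lia

lemma Nat.Prime.dvd_sum_range_sq {p : ℕ} (hp : p.Prime) (h3 : 3 < p) :
    (p : ℤ) ∣ ∑ i ∈ Finset.range p, (i : ℤ) ^ 2 := by
  have h : (p : ℤ) ∣ 2 * (3 * ∑ i ∈ Finset.range p, (i : ℤ) ^ 2) := by
    rw [← mul_assoc, show (2 * 3 : ℤ) = 6 by norm_num, six_mul_sum_range_sq]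
    exact Dvd.dvd.mul_right (Dvd.intro_left _ rfl) _
  have hp' := Nat.prime_iff_prime_int.mp hp
  have aux (c : ℤ) (hc : 0 < c) (hc' : c < p) : ¬ (p : ℤ) ∣ c :=
    fun h' => absurd (Int.le_of_dvd hc h') (by lia)
  exact (hp'.dvd_or_dvd ((hp'.dvd_or_dvd h).resolve_left
    (aux 2 (by norm_num) (by lia)))).resolve_left (aux 3 (by norm_num) (by lia))

lemma intCast_polyIter (m : ℕ) (f : Polynomial ℤ) (k : ℕ) (a : ℤ) :
    ((polyIter f k a : ℤ) : ZMod m) = (polyMap m f)^[k] (a : ZMod m) := by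
  refine Function.Semiconj.iterate_right (f := ((↑) : ℤ → ZMod m)) (fun x => ?_) k a
  simpa [polyMap] using (Polynomial.aeval_algebraMap_apply (ZMod m) x f).symm

lemma multiplier_intCast (m : ℕ) (f : Polynomial ℤ) (k : ℕ) (a : ℤ) :
    multiplier m f k (a : ZMod m) =
      ((∏ i ∈ Finset.range k, f.derivative.eval (polyIter f i a) : ℤ) : ZMod m) := by
  rw [multiplier, Int.cast_prod]
  refine Finset.prod_congr rfl fun i _ => ?_
  rw [← intCast_polyIter]
  simpa using Polynomial.aeval_algebraMap_apply (ZMod m) (polyIter f i a) f.derivative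

lemma eval_iterate_comp_X (f : Polynomial ℤ) (k : ℕ) (a : ℤ) :
    (f.comp^[k] Polynomial.X).eval a = polyIter f k a := by
  rw [Polynomial.iterate_comp_eval, Polynomial.eval_X, polyIter]

lemma eval_derivative_iterate_comp_X (f : Polynomial ℤ) (k : ℕ) (a : ℤ) :
    (f.comp^[k] Polynomial.X).derivative.eval a =
      ∏ i ∈ Finset.range k, f.derivative.eval (polyIter f i a) := by
  induction k with
  | zero => simp
  | succ k ih =>
    rw [Function.iterate_succ_apply', Polynomial.derivative_comp, Polynomial.eval_mul, ih,
      Polynomial.eval_comp, eval_iterate_comp_X, Finset.prod_range_succ]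

lemma isPeriodicPt_polyMap_iff (m : ℕ) (f : Polynomial ℤ) (k : ℕ) (a : ℤ) :
    Function.IsPeriodicPt (polyMap m f) k (a : ZMod m) ↔ (m : ℤ) ∣ polyIter f k a - a := by
  rw [Function.IsPeriodicPt, Function.IsFixedPt, ← intCast_polyIter, eq_comm,
    ZMod.intCast_eq_intCast_iff_dvd_sub]

/-- Let `p > 3` be prime, or `p = 3` and `n > 1`. Let `v ∈ ZMod p^n` be a
periodic point of `F_{p^n}` of minimal period `k` with `λ̄(v) = 1` in `ZMod p` and `r_v ≠ 0`.
If `w ∈ ZMod p^{n+1}` is a lift of `v` that is a periodic point of `F_{p^{n+1}}` (of minimal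
period `k'`), then `r_w ≠ 0`, where `r_v, r_w ∈ [0, p)` are determined by
`f^{∘k}(a_v) ≡ a_v + r_v·p^n (mod p^{n+1})` and
`f^{∘k'}(a_w) ≡ a_w + r_w·p^{n+1} (mod p^{n+2})`. -/
theorem r_ne_zero_lifts (p : ℕ) (hp : p.Prime) (n : ℕ) (hn : n ≠ 0)
    (hpn : 3 < p ∨ (p = 3 ∧ 1 < n))
    (f : Polynomial ℤ) (k : ℕ) (v : ZMod (p ^ n))
    (hv : v ∈ Function.periodicPts (polyMap (p ^ n) f))
    (hk : Function.minimalPeriod (polyMap (p ^ n) f) v = k)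
    (hlam : ZMod.castHom (dvd_pow_self p hn) (ZMod p) (multiplier (p ^ n) f k v) = 1)
    (r : ℕ) (hrp : r < p)
    (hr : polyIter f k (v.val : ℤ) ≡
      (v.val : ℤ) + (r : ℤ) * (p : ℤ) ^ n [ZMOD (p : ℤ) ^ (n + 1)])
    (hr0 : r ≠ 0)
    (w : ZMod (p ^ (n + 1)))
    (hw : ZMod.castHom (pow_dvd_pow p (Nat.le_succ n)) (ZMod (p ^ n)) w = v)
    (hwper : w ∈ Function.periodicPts (polyMap (p ^ (n + 1)) f))
    (k' : ℕ) (hk' : Function.minimalPeriod (polyMap (p ^ (n + 1)) f) w = k')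
    (r' : ℕ) (hr'p : r' < p)
    (hr' : polyIter f k' (w.val : ℤ) ≡
      (w.val : ℤ) + (r' : ℤ) * (p : ℤ) ^ (n + 1) [ZMOD (p : ℤ) ^ (n + 2)]) :
    r' ≠ 0 := by
  have hpi := Nat.prime_iff_prime_int.mp hp
  have hp0 : (p : ℤ) ≠ 0 := hpi.ne_zero
  obtain ⟨m, rfl⟩ : ∃ m, n = m + 1 := Nat.exists_eq_succ_of_ne_zero hn
  have : NeZero (p ^ (m + 1)) := ⟨pow_ne_zero _ hp.ne_zero⟩
  have : NeZero (p ^ (m + 1 + 1)) := ⟨pow_ne_zero _ hp.ne_zero⟩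
  have hva : ((v.val : ℤ) : ZMod (p ^ (m + 1))) = v := by simp
  have hwa : ((w.val : ℤ) : ZMod (p ^ (m + 1 + 1))) = w := by simp
  generalize (v.val : ℤ) = b at hva hr
  generalize (w.val : ℤ) = a at hwa hr'
  subst hva hwa
  rw [map_intCast, ZMod.intCast_eq_intCast_iff_dvd_sub] at hw
  obtain ⟨t, ht⟩ := hw
  push_cast at ht
  have hab : (p : ℤ) ∣ a - b := ⟨-(p ^ m * t), by linear_combination -ht⟩
  rw [multiplier_intCast, map_intCast, ← eval_derivative_iterate_comp_X, ← Int.cast_one,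
    ZMod.intCast_eq_intCast_iff_dvd_sub] at hlam
  set g := f.comp^[k] Polynomial.X with hgdef
  have hgk (j : ℕ) (x : ℤ) : polyIter f (k * j) x = (fun y => g.eval y)^[j] x := by
    rw [polyIter, Function.iterate_mul]
    congr 1
    funext y
    exact (eval_iterate_comp_X f k y).symm
  obtain ⟨u, hu⟩ : ∃ u, g.derivative.eval a = 1 + p * u := by
    obtain ⟨u, hu⟩ := (hab.trans (Polynomial.sub_dvd_eval_sub a b g.derivative)).sub hlam
    exact ⟨u, by linear_combination hu⟩
  obtain ⟨s, hs, hps⟩ : ∃ s, g.eval a = a + p ^ (m + 1) * s ∧ ¬ (p : ℤ) ∣ s := by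
    obtain ⟨d, hd⟩ := hr.dvd
    rw [← eval_iterate_comp_X] at hd
    obtain ⟨u₀, hu₀⟩ := hlam
    obtain ⟨c, hc⟩ := Polynomial.binomExpansion g b (a - b)
    rw [add_sub_cancel] at hc
    refine ⟨r + p * (u₀ * t + p ^ m * c * t ^ 2 - d), ?_, fun h => hr0 ?_⟩
    · have ht' : a = b - p ^ (m + 1) * t := by linear_combination -ht
      rw [hc, ht']
      rw [← hgdef] at hd
      rw [pow_succ _ (m + 1)] at hd
      rw [pow_succ] at hd ⊢
      generalize (p : ℤ) ^ m = q at *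
      linear_combination -hd + p * q * t * hu₀
    · rw [dvd_add_left (Dvd.intro _ rfl), Int.natCast_dvd_natCast] at h
      exact Nat.eq_zero_of_dvd_of_lt h hrp
  obtain ⟨h, hh⟩ := exists_iterate_eval_eq g p a s u m hs hu
  obtain ⟨j, rfl⟩ : k ∣ k' := by
    rw [← hk, ← Function.isPeriodicPt_iff_minimalPeriod_dvd, isPeriodicPt_polyMap_iff]
    have h1 := (isPeriodicPt_polyMap_iff _ f k' a).mp
      (hk' ▸ Function.isPeriodicPt_minimalPeriod _ _)
    have h2 : ((p ^ (m + 1) : ℕ) : ℤ) ∣ b - a := ⟨t, by push_cast; exact ht⟩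
    have h3 : b - a ∣ polyIter f k' b - polyIter f k' a := by
      simp_rw [← eval_iterate_comp_X]
      exact Polynomial.sub_dvd_eval_sub _ _ _
    have h4 : ((p ^ (m + 1) : ℕ) : ℤ) ∣ polyIter f k' a - a :=
      (Int.natCast_dvd_natCast.mpr (pow_dvd_pow p (Nat.le_succ _))).trans h1
    have := ((h2.trans h3).add h4).sub h2
    rwa [show polyIter f k' b - polyIter f k' a + (polyIter f k' a - a) - (b - a) =
      polyIter f k' b - b by ring] at this
  have hk0 : 0 < k := hk ▸ Function.minimalPeriod_pos_of_mem_periodicPts hv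
  have hpj : p ∣ j := by
    have h1 := (isPeriodicPt_polyMap_iff _ f (k * j) a).mp
      (hk' ▸ Function.isPeriodicPt_minimalPeriod _ _)
    obtain ⟨e, he⟩ := hh j
    rw [hgk, he, add_sub_cancel_left, Nat.cast_pow, pow_succ (p : ℤ) (m + 1),
      mul_dvd_mul_iff_left (pow_ne_zero _ hp0), pow_two (p : ℤ), mul_assoc (p : ℤ) p e,
      dvd_add_left (Dvd.intro _ rfl), dvd_add_left (Dvd.intro _ rfl)] at h1
    exact Int.natCast_dvd_natCast.mp ((hpi.dvd_or_dvd h1).resolve_right hps)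
  obtain ⟨e, he⟩ := hh p
  have hjp : j ∣ p := by
    rw [← Nat.mul_dvd_mul_iff_left hk0, ← hk', ← Function.isPeriodicPt_iff_minimalPeriod_dvd,
      isPeriodicPt_polyMap_iff, hgk, he, add_sub_cancel_left, Nat.cast_pow,
      pow_succ (p : ℤ) (m + 1), mul_dvd_mul_iff_left (pow_ne_zero _ hp0), pow_two (p : ℤ),
      mul_assoc (p : ℤ) p e]
    exact ((Dvd.intro _ rfl).add (Dvd.intro _ rfl)).add (Dvd.intro _ rfl)
  obtain rfl := Nat.dvd_antisymm hjp hpj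
  have hB : (j : ℤ) ∣ u * s * ∑ i ∈ Finset.range j, (i : ℤ) +
      h * j ^ m * s ^ 2 * ∑ i ∈ Finset.range j, (i : ℤ) ^ 2 := by
    refine ((hp.dvd_sum_range_intCast (by lia)).mul_left _).add ?_
    rcases hpn with h3 | ⟨-, hm⟩
    · exact (hp.dvd_sum_range_sq h3).mul_left _
    · exact (((dvd_pow_self _ (by lia)).mul_left _).mul_right _).mul_right _
  obtain ⟨B, hB⟩ := hB
  rw [hB] at he
  rintro rfl
  obtain ⟨d, hd⟩ := hr'.dvd
  rw [hgk, he] at hd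
  refine hps ⟨-(B + e + d), mul_left_cancel₀ (pow_ne_zero (m + 2) hp0) ?_⟩
  push_cast at hd
  linear_combination -hd
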